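/- Let 𝒪 be an open subset of ℳ with d(ρ̄, 𝒪) > 0, and let A_N = {η ∈ Ω_N : π^N(η) ∈ 𝒪}. Then there exists a > 0 such that, for all N sufficiently large, r_N(A_N^c, A_N) ≤ e^{−aN} and ν^N_{α,β}(A_N) ≤ e^{−aN}, where r_N(A_N^c, A_N) is the average jump rate of the BDSSEP from A_N^c into A_N. -/

import Mathlib

open MeasureTheory ENNReal Filter Topology Set

noncomputable section

/-- First hitting time (after time `0`) of a set `A` by a path `ω`, with value `∞`
if the path never visits `A`. -/
def hitTime {S : Type*} (A : Set S) (ω : NNReal → S) : ℝ≥0∞ :=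
  sInf {t : ℝ≥0∞ | ∃ s : NNReal, (s : ℝ≥0∞) = t ∧ 0 < s ∧ ω s ∈ A}

/-- Return time of a set `A`: first time the path is in `A` after having moved away
from its initial state. -/
def hitTimePlus {S : Type*} (A : Set S) (ω : NNReal → S) : ℝ≥0∞ :=
  sInf {t : ℝ≥0∞ | ∃ s : NNReal, (s : ℝ≥0∞) = t ∧ 0 < s ∧ ω s ∈ A ∧
    ∃ r : NNReal, 0 < r ∧ r < s ∧ ω r ≠ ω 0}

/-- An irreducible continuous-time Markov chain on a finite state space `S`:
jump rates `R`, path-space laws `P η` (law of the process started at `η`),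
and unique stationary probability vector `ν`. -/
structure CTMC (S : Type*) [Fintype S] [MeasurableSpace S] where
  R : S → S → ℝ
  R_nonneg : ∀ η ξ, 0 ≤ R η ξ
  R_diag : ∀ η, R η η = 0
  P : S → Measure (NNReal → S)
  P_prob : ∀ η, IsProbabilityMeasure (P η)
  P_start : ∀ η, P η {ω | ω 0 = η} = 1
  markov : ∀ (η ζ : S) (s : NNReal) (B : Set (NNReal → S)), MeasurableSet B →
    P η ({ω | ω s = ζ} ∩ {ω | (fun t => ω (s + t)) ∈ B})
      = P η {ω | ω s = ζ} * P ζ B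
  jump_rate : ∀ η ξ, η ≠ ξ →
    Tendsto (fun t : NNReal => ((P η) {ω | ω t = ξ}).toReal / (t : ℝ))
      (nhdsWithin 0 (Set.Ioi 0)) (nhds (R η ξ))
  irreducible : ∀ η ξ : S, ∃ (n : ℕ) (c : Fin (n + 1) → S),
    c 0 = η ∧ c (Fin.last n) = ξ ∧ ∀ i : Fin n, 0 < R (c i.castSucc) (c i.succ)
  ν : S → ℝ
  ν_pos : ∀ η, 0 < ν η
  ν_sum : ∑ η, ν η = 1
  stationary : ∀ (t : NNReal) (ξ : S),
    ∑ η, ν η * ((P η) {ω | ω t = ξ}).toReal = ν ξ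

namespace CTMC

variable {S : Type*} [Fintype S] [MeasurableSpace S]

/-- Mass `ν(A)` of a set under the stationary measure. -/
def nuSet (c : CTMC S) (A : Set S) : ℝ := ∑ η, A.indicator c.ν η

/-- Total jump rate `R(η, A)` from a state `η` into a set `A`. -/
def rateTo (c : CTMC S) (η : S) (A : Set S) : ℝ := ∑ ξ, A.indicator (c.R η) ξ

/-- Holding rate `λ(η)` of a state. -/
def lam (c : CTMC S) (η : S) : ℝ := ∑ ξ, c.R η ξ

/-- The average rate `r(Aᶜ, A)` at which the process jumps from `Aᶜ` to `A`. -/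
def avgRate (c : CTMC S) (A : Set S) : ℝ :=
  (c.nuSet Aᶜ)⁻¹ * ∑ η, Aᶜ.indicator (fun η => c.ν η * c.rateTo η A) η

/-- Law of the process with initial distribution `μ`. -/
def Pmu (c : CTMC S) (μ : S → ℝ) : Measure (NNReal → S) :=
  ∑ η, (ENNReal.ofReal (μ η)) • c.P η

/-- Law of the stationary process. -/
def Pnu (c : CTMC S) : Measure (NNReal → S) := c.Pmu c.ν

/-- Expectation `E_ν[H_A]` of the hitting time of `A` for the stationary process. -/
def expHitNu (c : CTMC S) (A : Set S) : ℝ :=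
  (∫⁻ ω, hitTime A ω ∂ c.Pnu).toReal

/-- Transition probability `p_t(η, ξ)`. -/
def trans (c : CTMC S) (t : NNReal) (η ξ : S) : ℝ := ((c.P η) {ω | ω t = ξ}).toReal

/-- The mixing time `T^mix = inf { t > 0 : max_η ‖P_t(η, ·) − ν‖_TV ≤ 1/4 }`. -/
def tmix (c : CTMC S) : ℝ :=
  sInf {t : ℝ | 0 < t ∧ ∀ η : S,
    (1 / 2) * ∑ ξ, |c.trans t.toNNReal η ξ - c.ν ξ| ≤ 1 / 4}

/-- Tail probability `P_ν[H_A > t]`. -/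
def tailNu (c : CTMC S) (A : Set S) (t : ℝ) : ℝ :=
  (c.Pnu {ω | ENNReal.ofReal t < hitTime A ω}).toReal

/-- Tail probability `P_μ[H_A > t]`. -/
def tailMu (c : CTMC S) (μ : S → ℝ) (A : Set S) (t : ℝ) : ℝ :=
  (c.Pmu μ {ω | ENNReal.ofReal t < hitTime A ω}).toReal

/-- Capacity `Cap(A, B) = Σ_{η ∈ A} ν(η) λ(η) P_η[H_B < H⁺_A]`. -/
def capacity (c : CTMC S) (A B : Set S) : ℝ :=
  ∑ η, A.indicator (fun η =>
    c.ν η * c.lam η * ((c.P η) {ω | hitTime B ω < hitTimePlus A ω}).toReal) η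

end CTMC

end
noncomputable section

/-! ### The boundary driven symmetric simple exclusion process -/

/-- Configurations of the BDSSEP on `Λ_N = {1, …, N−1}`: the site `x = i + 1 ∈ Λ_N`
corresponds to the index `i : Fin (N-1)`. -/
abbrev Config (N : ℕ) := Fin (N - 1) → Bool

/-- The configuration obtained by interchanging the occupation variables at `x` and `y`. -/
def swapConf {n : ℕ} (x y : Fin n) (η : Fin n → Bool) : Fin n → Bool :=
  fun z => if z = x then η y else if z = y then η x else η z

/-- The configuration obtained by flipping the occupation variable at `x`. -/
def flipConf {n : ℕ} (x : Fin n) (η : Fin n → Bool) : Fin n → Bool :=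
  Function.update η x (!η x)

/-- Jump rates of the BDSSEP with boundary densities `α`, `β`: nearest-neighbour
exchanges at rate `1/2`, creation/annihilation at the left boundary site at rates
`α/2`, `(1−α)/2` and at the right boundary site at rates `β/2`, `(1−β)/2`. -/
def bdssepR (N : ℕ) (α β : ℝ) (η ξ : Config N) : ℝ :=
  (∑ x : Fin (N - 1), ∑ y : Fin (N - 1),
    if (y : ℕ) = (x : ℕ) + 1 ∧ ξ = swapConf x y η ∧ ξ ≠ η then (1 : ℝ) / 2 else 0)
  + (∑ x : Fin (N - 1),
      if (x : ℕ) = 0 ∧ ξ = flipConf x η then (if η x then (1 - α) / 2 else α / 2) else 0)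
  + (∑ x : Fin (N - 1),
      if (x : ℕ) = N - 2 ∧ ξ = flipConf x η then (if η x then (1 - β) / 2 else β / 2) else 0)

/-! ### The space `ℳ` of density profiles -/

/-- A function `γ` is a density profile (an element of `ℳ`) if `0 ≤ γ ≤ 1` on `[0,1]`. -/
def memM (γ : ℝ → ℝ) : Prop := ∀ x ∈ Set.Icc (0 : ℝ) 1, 0 ≤ γ x ∧ γ x ≤ 1

/-- The pairing `⟨γ, G⟩ = ∫₀¹ γ(x) G(x) dx`. -/
def pairing (γ G : ℝ → ℝ) : ℝ := ∫ x in (0 : ℝ)..1, γ x * G x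

/-- The distance on `ℳ` associated to a sequence `F` of continuous test functions bounded
by one: `d(γ, γ') = Σ_k 2^{-k} |⟨γ, F_k⟩ − ⟨γ', F_k⟩|`. -/
def profDist (F : ℕ → ℝ → ℝ) (γ γ' : ℝ → ℝ) : ℝ :=
  ∑' k : ℕ, (1 / 2 : ℝ) ^ (k + 1) * |pairing γ (F k) - pairing γ' (F k)|

/-- A subset of `ℳ` is open (for the metric `d`) if around each of its points it contains
a `d`-ball of `ℳ`. -/
def dOpen (F : ℕ → ℝ → ℝ) (O : Set (ℝ → ℝ)) : Prop :=
  ∀ γ ∈ O, ∃ ε > 0, ∀ γ', memM γ' → profDist F γ γ' < ε → γ' ∈ O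

/-- The closure in `ℳ` of a subset of `ℳ`, for the metric `d`. -/
def dClosure (F : ℕ → ℝ → ℝ) (O : Set (ℝ → ℝ)) : Set (ℝ → ℝ) :=
  {γ | memM γ ∧ ∀ ε > 0, ∃ γ' ∈ O, profDist F γ γ' < ε}

/-- The interior in `ℳ` of a subset of `ℳ`, for the metric `d`. -/
def dInterior (F : ℕ → ℝ → ℝ) (B : Set (ℝ → ℝ)) : Set (ℝ → ℝ) :=
  {γ | γ ∈ B ∧ ∃ ε > 0, ∀ γ', memM γ' → profDist F γ γ' < ε → γ' ∈ B}

/-- The empirical density profile `π^N(η) ∈ ℳ` of a configuration `η`: the site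
`x = i+1 ∈ Λ_N` contributes the indicator of `[x/N − 1/2N, x/N + 1/2N)`. -/
def empProfile (N : ℕ) (η : Config N) : ℝ → ℝ := fun x =>
  ∑ i : Fin (N - 1),
    if η i = true ∧ ((i : ℕ) + 1 : ℝ) / N - 1 / (2 * N) ≤ x ∧
        x < ((i : ℕ) + 1 : ℝ) / N + 1 / (2 * N)
    then 1 else 0

/-- The stationary density profile `ρ̄_{α,β}`, the solution of `Δρ = 0`, `ρ(0) = α`,
`ρ(1) = β`. -/
def rhoBar (α β : ℝ) : ℝ → ℝ := fun x => α + (β - α) * x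

end

namespace CTMC

variable {S : Type*} [Fintype S] [MeasurableSpace S]

/-- The transition probabilities out of a state sum to one. -/
lemma sum_trans [MeasurableSingletonClass S] (c : CTMC S) (t : NNReal) (η : S) :
    ∑ ξ, c.trans t η ξ = 1 := by
  have := c.P_prob η
  have hm : ∀ ξ : S, MeasurableSet {ω : NNReal → S | ω t = ξ} := fun ξ =>
    (measurable_pi_apply t : Measurable fun ω : NNReal → S => ω t) (measurableSet_singleton ξ)
  have h := measure_biUnion_finset (μ := c.P η) (s := (Finset.univ : Finset S))
    (f := fun ξ => {ω : NNReal → S | ω t = ξ})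
    (fun i _ j _ hij => Set.disjoint_left.2 fun ω hi hj => hij (hi.symm.trans hj))
    (fun ξ _ => hm ξ)
  have hU : (⋃ ξ ∈ (Finset.univ : Finset S), {ω : NNReal → S | ω t = ξ}) = Set.univ := by
    ext ω; simp
  rw [hU, measure_univ] at h
  simp only [trans]
  rw [← ENNReal.toReal_sum (fun ξ _ => measure_ne_top _ _), ← h, ENNReal.toReal_one]

/-- The stationary measure annihilates the range of the generator. -/
lemma sum_nu_mul_generator [MeasurableSingletonClass S] (c : CTMC S) (h : S → ℝ) :
    ∑ η, c.ν η * ∑ ξ, c.R η ξ * (h ξ - h η) = 0 := by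
  have hzero : ∀ t : NNReal,
      ∑ η, c.ν η * ∑ ξ, c.trans t η ξ / (t : ℝ) * (h ξ - h η) = 0 := by
    intro t
    have h1 : ∑ η, c.ν η * ∑ ξ, c.trans t η ξ * h ξ = ∑ ξ, c.ν ξ * h ξ := by
      simp_rw [Finset.mul_sum]
      rw [Finset.sum_comm]
      refine Finset.sum_congr rfl fun ξ _ => ?_
      rw [← c.stationary t ξ, Finset.sum_mul]
      exact Finset.sum_congr rfl fun η _ => by rw [trans]; ring
    have h2 : ∑ η, c.ν η * ∑ ξ, c.trans t η ξ * h η = ∑ ξ, c.ν ξ * h ξ := by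
      refine Finset.sum_congr rfl fun η _ => ?_
      rw [← Finset.sum_mul, c.sum_trans, one_mul]
    have h3 : ∑ η, c.ν η * ∑ ξ, c.trans t η ξ / (t : ℝ) * (h ξ - h η)
        = (t : ℝ)⁻¹ * (∑ η, c.ν η * ∑ ξ, c.trans t η ξ * h ξ
          - ∑ η, c.ν η * ∑ ξ, c.trans t η ξ * h η) := by
      simp_rw [← Finset.sum_sub_distrib, ← mul_sub, ← Finset.sum_sub_distrib, Finset.mul_sum]
      exact Finset.sum_congr rfl fun η _ => Finset.sum_congr rfl fun ξ _ => by ring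
    rw [h3, h1, h2, sub_self, mul_zero]
  have hlim : Tendsto (fun t : NNReal =>
      ∑ η, c.ν η * ∑ ξ, c.trans t η ξ / (t : ℝ) * (h ξ - h η)) (𝓝[>] 0)
      (𝓝 (∑ η, c.ν η * ∑ ξ, c.R η ξ * (h ξ - h η))) := by
    refine tendsto_finsetSum _ fun η _ => Tendsto.const_mul _ <|
      tendsto_finsetSum _ fun ξ _ => ?_
    by_cases hne : η = ξ
    · subst hne; simp
    · exact (c.jump_rate η ξ hne).mul_const _
  simp_rw [hzero] at hlim
  exact (tendsto_nhds_unique hlim tendsto_const_nhds)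

lemma nuSet_nonneg (c : CTMC S) (A : Set S) : 0 ≤ c.nuSet A :=
  Finset.sum_nonneg fun η _ => Set.indicator_nonneg (fun η _ => (c.ν_pos η).le) η

lemma nuSet_add_nuSet_compl (c : CTMC S) (A : Set S) : c.nuSet A + c.nuSet Aᶜ = 1 := by
  rw [nuSet, nuSet, ← Finset.sum_add_distrib, ← c.ν_sum]
  exact Finset.sum_congr rfl fun η _ => congrFun (Set.indicator_self_add_compl A c.ν) η

/-- In the stationary state the flow into `A` is at most `Λ ν(A)` when all holding rates are
at most `Λ`. -/
lemma avgRate_le [MeasurableSingletonClass S] (c : CTMC S) (A : Set S) {Λ : ℝ}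
    (hΛ : ∀ η, c.lam η ≤ Λ) (hA : c.nuSet A ≤ 1 / 2) :
    c.avgRate A ≤ 2 * Λ * c.nuSet A := by
  classical
  have hcompl := c.nuSet_add_nuSet_compl A
  have hflow : ∑ η, Aᶜ.indicator (fun η => c.ν η * c.rateTo η A) η ≤ Λ * c.nuSet A := by
    have hst := c.sum_nu_mul_generator (A.indicator 1)
    rw [nuSet, Finset.mul_sum, ← sub_nonpos, ← Finset.sum_sub_distrib, ← hst]
    refine Finset.sum_le_sum fun η _ => ?_
    by_cases hη : η ∈ A
    · simp only [Set.indicator, Set.mem_compl_iff, hη, not_true_eq_false, if_false, if_true,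
        Pi.one_apply]
      have : -c.lam η ≤ ∑ ξ, c.R η ξ * ((if ξ ∈ A then 1 else 0) - 1) := by
        rw [lam, ← Finset.sum_neg_distrib]
        refine Finset.sum_le_sum fun ξ _ => ?_
        have := c.R_nonneg η ξ
        split_ifs <;> linarith
      nlinarith [c.ν_pos η, hΛ η]
    · simp only [Set.indicator, Set.mem_compl_iff, hη, not_false_eq_true, if_false, if_true,
        Pi.one_apply, rateTo, mul_zero, sub_zero]
      simp
  have hpos : (1 : ℝ) / 2 ≤ c.nuSet Aᶜ := by linarith
  have hinv : (c.nuSet Aᶜ)⁻¹ ≤ 2 := by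
    rw [inv_le_comm₀ (by linarith) (by norm_num)]; linarith
  have hnn : 0 ≤ ∑ η, Aᶜ.indicator (fun η => c.ν η * c.rateTo η A) η :=
    Finset.sum_nonneg fun η _ => Set.indicator_nonneg (fun η _ => mul_nonneg (c.ν_pos η).le
      (Finset.sum_nonneg fun ξ _ => Set.indicator_nonneg (fun ξ _ => c.R_nonneg η ξ) ξ)) η
  rw [avgRate]
  nlinarith

end CTMC

/-! ### The generator and the correlation inequality -/

/-- The generator of the BDSSEP acting on `h`, on `m + 1` sites. -/
noncomputable def bdssepGen {m : ℕ} (α β : ℝ) (h : (Fin (m + 1) → Bool) → ℝ) (η : Fin (m + 1) → Bool) : ℝ :=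
  ∑ i : Fin m, 1 / 2 * (h (swapConf i.castSucc i.succ η) - h η)
  + (if η 0 then (1 - α) / 2 else α / 2) * (h (flipConf 0 η) - h η)
  + (if η (Fin.last m) then (1 - β) / 2 else β / 2) * (h (flipConf (Fin.last m) η) - h η)

/-- A double sum over ordered pairs of neighbouring sites is a sum over bonds. -/
lemma sum_ite_succ {m : ℕ} (φ : Fin (m + 1) → Fin (m + 1) → ℝ) :
    ∑ x : Fin (m + 1), ∑ y : Fin (m + 1), (if (y : ℕ) = (x : ℕ) + 1 then φ x y else 0)
      = ∑ i : Fin m, φ i.castSucc i.succ := by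
  rw [Fin.sum_univ_castSucc]
  have hlast : ∑ y : Fin (m + 1),
      (if (y : ℕ) = (Fin.last m : ℕ) + 1 then φ (Fin.last m) y else 0) = 0 :=
    Finset.sum_eq_zero fun y _ => if_neg (by simp; omega)
  rw [hlast, add_zero]
  refine Finset.sum_congr rfl fun i _ => ?_
  rw [Finset.sum_eq_single i.succ]
  · simp
  · intro y _ hy
    refine if_neg fun h => hy (Fin.ext ?_)
    simp [h]
  · simp

lemma sum_bdssepR_mul {m : ℕ} (α β : ℝ) (h : Config (m + 2) → ℝ) (η : Config (m + 2)) :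
    ∑ ξ, bdssepR (m + 2) α β η ξ * (h ξ - h η) = bdssepGen (m := m) α β h η := by
  have hflip : ∀ (p : Fin (m + 1) → Prop) [DecidablePred p] (r : Fin (m + 1) → ℝ)
      (x₀ : Fin (m + 1)) (_ : ∀ x, p x ↔ x = x₀),
      ∑ ξ : Fin (m + 1) → Bool, (∑ x : Fin (m + 1),
        if p x ∧ ξ = flipConf x η then r x else 0) * (h ξ - h η)
        = r x₀ * (h (flipConf x₀ η) - h η) := by
    intro p _ r x₀ hp
    simp_rw [Finset.sum_mul]
    rw [Finset.sum_comm]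
    rw [Finset.sum_eq_single x₀]
    · rw [Finset.sum_eq_single (flipConf x₀ η)]
      · rw [if_pos ⟨(hp x₀).2 rfl, rfl⟩]
      · intro ξ _ hξ; simp [hξ]
      · simp
    · intro x _ hx
      refine Finset.sum_eq_zero fun ξ _ => ?_
      rw [if_neg fun h' => hx ((hp x).1 h'.1), zero_mul]
    · simp
  have hswap : ∑ ξ : Fin (m + 1) → Bool, (∑ x : Fin (m + 1), ∑ y : Fin (m + 1),
      if (y : ℕ) = (x : ℕ) + 1 ∧ ξ = swapConf x y η ∧ ξ ≠ η then (1 : ℝ) / 2 else 0)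
        * (h ξ - h η) = ∑ i : Fin m, 1 / 2 * (h (swapConf i.castSucc i.succ η) - h η) := by
    rw [← sum_ite_succ (fun x y => 1 / 2 * (h (swapConf x y η) - h η))]
    simp_rw [Finset.sum_mul]
    rw [Finset.sum_comm]
    refine Finset.sum_congr rfl fun x _ => ?_
    rw [Finset.sum_comm]
    refine Finset.sum_congr rfl fun y _ => ?_
    rw [Finset.sum_eq_single (swapConf x y η)]
    · by_cases hs : swapConf x y η = η
      · simp [hs]
      · simp [hs]
    · intro ξ _ hξ; simp [hξ]
    · simp
  rw [bdssepGen, ← hswap,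
    ← hflip (fun x => (x : ℕ) = 0) (fun x => if η x then (1 - α) / 2 else α / 2) 0
      (fun x => (Fin.ext_iff (b := 0)).symm),
    ← hflip (fun x => (x : ℕ) = m) (fun x => if η x then (1 - β) / 2 else β / 2) (Fin.last m)
      (fun x => (Fin.ext_iff (b := Fin.last m)).symm),
    ← Finset.sum_add_distrib, ← Finset.sum_add_distrib]
  refine Finset.sum_congr rfl fun ξ _ => ?_
  rw [← add_mul, ← add_mul]
  rfl

/-- A crude polynomial bound on the holding rates. -/
lemma sum_bdssepR_le {N : ℕ} {α β : ℝ} (hα : 0 < α) (hα' : α < 1) (hβ : 0 < β) (hβ' : β < 1)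
    (η : Config N) : ∑ ξ, bdssepR N α β η ξ ≤ (N : ℝ) ^ 2 + 2 * N := by
  have hn : ((N - 1 : ℕ) : ℝ) ≤ N := by exact_mod_cast Nat.sub_le N 1
  have hn0 : (0 : ℝ) ≤ ((N - 1 : ℕ) : ℝ) := Nat.cast_nonneg _
  have hflip : ∀ (p : Fin (N - 1) → Prop) [DecidablePred p] (r : Fin (N - 1) → ℝ)
      (_ : ∀ x, 0 ≤ r x ∧ r x ≤ 1),
      ∑ ξ : Config N, (∑ x : Fin (N - 1),
        if p x ∧ ξ = flipConf x η then r x else 0) ≤ N := by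
    intro p _ r hr
    rw [Finset.sum_comm]
    calc _ ≤ ∑ x : Fin (N - 1), (1 : ℝ) := by
          refine Finset.sum_le_sum fun x _ => ?_
          rw [Finset.sum_eq_single (flipConf x η)]
          · split_ifs
            exacts [(hr x).2, zero_le_one]
          · intro ξ _ hξ; simp [hξ]
          · simp
      _ ≤ N := by simp [hn]
  have hswap : ∑ ξ : Config N, (∑ x : Fin (N - 1), ∑ y : Fin (N - 1),
      if (y : ℕ) = (x : ℕ) + 1 ∧ ξ = swapConf x y η ∧ ξ ≠ η then (1 : ℝ) / 2 else 0)
        ≤ (N : ℝ) ^ 2 := by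
    rw [Finset.sum_comm]
    calc _ ≤ ∑ x : Fin (N - 1), ∑ y : Fin (N - 1), (1 : ℝ) := by
          refine Finset.sum_le_sum fun x _ => ?_
          rw [Finset.sum_comm]
          refine Finset.sum_le_sum fun y _ => ?_
          rw [Finset.sum_eq_single (swapConf x y η)]
          · split_ifs <;> norm_num
          · intro ξ _ hξ; simp [hξ]
          · simp
      _ ≤ (N : ℝ) ^ 2 := by
          simp only [Finset.sum_const, Finset.card_univ, Fintype.card_fin, nsmul_eq_mul, mul_one]
          nlinarith
  have h1 := hflip (fun x => (x : ℕ) = 0) (fun x => if η x then (1 - α) / 2 else α / 2)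
    (fun x => by split_ifs <;> constructor <;> linarith)
  have h2 := hflip (fun x => (x : ℕ) = N - 2) (fun x => if η x then (1 - β) / 2 else β / 2)
    (fun x => by split_ifs <;> constructor <;> linarith)
  simp only [bdssepR, Finset.sum_add_distrib]
  linarith

/-- The product of `f` over the sites occupied in `ξ`. -/
def prodOn {n : ℕ} (f : Fin n → ℝ) (ξ : Fin n → Bool) : ℝ := ∏ x, if ξ x then f x else 1

lemma prodOn_update {n : ℕ} (f : Fin n → ℝ) (ξ : Fin n → Bool) {x : Fin n} (hx : ξ x = true) :
    prodOn f ξ = f x * prodOn f (Function.update ξ x false) := by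
  rw [prodOn, prodOn, ← Finset.mul_prod_erase _ _ (Finset.mem_univ x),
    ← Finset.mul_prod_erase Finset.univ (fun z => if Function.update ξ x false z then f z else 1)
      (Finset.mem_univ x)]
  simp only [hx, if_true, Function.update_self, Bool.false_eq_true, if_false, one_mul]
  congr 1
  refine Finset.prod_congr rfl fun z hz => ?_
  rw [Function.update_of_ne (Finset.ne_of_mem_erase hz)]

lemma prodOn_congr {n : ℕ} {f g : Fin n → ℝ} {ξ : Fin n → Bool}
    (h : ∀ z, ξ z = true → f z = g z) : prodOn f ξ = prodOn g ξ :=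
  Finset.prod_congr rfl fun z _ => by split_ifs with hz <;> simp_all

lemma prodOn_nonneg {n : ℕ} {f : Fin n → ℝ} (hf : ∀ x, 0 ≤ f x) (ξ : Fin n → Bool) :
    0 ≤ prodOn f ξ :=
  Finset.prod_nonneg fun x _ => by split_ifs; exacts [hf x, zero_le_one]

lemma swapConf_eq_comp {n : ℕ} (x y : Fin n) (η : Fin n → Bool) :
    swapConf x y η = η ∘ Equiv.swap x y := by
  funext z
  simp only [swapConf, Function.comp, Equiv.swap_apply_def]
  split_ifs <;> rfl

lemma swapConf_eq_self {n : ℕ} {x y : Fin n} {η : Fin n → Bool} (h : η x = η y) :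
    swapConf x y η = η := by
  funext z
  simp only [swapConf]
  split_ifs with h1 h2
  · rw [h1, h]
  · rw [h2, h]
  · rfl

/-- Moving a particle from `x` to the empty site `y`, then deleting it, is deleting it at `x`. -/
lemma update_swapConf {n : ℕ} {x y : Fin n} {ξ : Fin n → Bool} (hy : ξ y = false) :
    Function.update (swapConf x y ξ) y false = Function.update ξ x false := by
  funext z
  simp only [Function.update_apply, swapConf]
  split_ifs <;> simp_all

lemma swapConf_comm {n : ℕ} (x y : Fin n) (ξ : Fin n → Bool) :
    swapConf x y ξ = swapConf y x ξ := by
  rw [swapConf_eq_comp, swapConf_eq_comp, Equiv.swap_comm]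

lemma prodOn_swapConf_sub {n : ℕ} (f : Fin n → ℝ) (ξ : Fin n → Bool) {x y : Fin n}
    (hx : ξ x = true) (hy : ξ y = false) :
    prodOn f (swapConf x y ξ) - prodOn f ξ
      = (f y - f x) * prodOn f (Function.update ξ x false) := by
  rw [prodOn_update f ξ hx, prodOn_update f (swapConf x y ξ) (x := y), update_swapConf hy]
  · ring
  · simp only [swapConf]; split_ifs <;> simp_all

/-- The indicators `1{η x = b}`, as a real function of the site. -/
def occ {n : ℕ} (b : Bool) (η : Fin n → Bool) (x : Fin n) : ℝ := if η x = b then 1 else 0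

/-- The density of sites in state `b` when the density of particles is `r`. -/
def stateDensity (b : Bool) (r : ℝ) : ℝ := if b then r else 1 - r

lemma prodOn_occ_swapConf {n : ℕ} (b : Bool) (ξ η : Fin n → Bool) (x y : Fin n) :
    prodOn (occ b (swapConf x y η)) ξ = prodOn (occ b η) (swapConf x y ξ) := by
  simp only [prodOn, occ, swapConf_eq_comp, Function.comp]
  refine Fintype.prod_equiv (Equiv.swap x y) _ _ fun z => ?_
  simp

lemma rate_mul_prodOn_flip {n : ℕ} (b : Bool) (r : ℝ) (ξ η : Fin n → Bool) (x : Fin n) :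
    (if η x then (1 - r) / 2 else r / 2)
        * (prodOn (occ b (flipConf x η)) ξ - prodOn (occ b η) ξ)
      = if ξ x then 1 / 2 * (stateDensity b r * prodOn (occ b η) (Function.update ξ x false)
          - prodOn (occ b η) ξ) else 0 := by
  have hoff : ∀ z, z ≠ x → occ b (flipConf x η) z = occ b η z := fun z hz => by
    simp [occ, flipConf, Function.update_of_ne hz]
  by_cases hξ : ξ x = true
  · rw [if_pos hξ, prodOn_update _ ξ hξ, prodOn_update (occ b η) ξ hξ,
      prodOn_congr (f := occ b (flipConf x η)) (g := occ b η)
        (ξ := Function.update ξ x false)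
        (fun z hz => hoff z (by rintro rfl; simp at hz))]
    by_cases hη : η x = true <;> cases b <;> simp [occ, flipConf, stateDensity, hη] <;> ring
  · rw [if_neg hξ, prodOn_congr (f := occ b (flipConf x η)) (g := occ b η)
      (fun z hz => hoff z (by rintro rfl; exact hξ hz)), sub_self, mul_zero]

/-- The generator of the dual process with absorption at the boundary. -/
noncomputable def dualGen {m : ℕ} (a b : ℝ) (f : (Fin (m + 1) → Bool) → ℝ)
    (ξ : Fin (m + 1) → Bool) : ℝ :=
  ∑ i : Fin m, 1 / 2 * (f (swapConf i.castSucc i.succ ξ) - f ξ)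
  + (if ξ 0 then 1 / 2 * (a * f (Function.update ξ 0 false) - f ξ) else 0)
  + (if ξ (Fin.last m) then
      1 / 2 * (b * f (Function.update ξ (Fin.last m) false) - f ξ) else 0)

lemma bdssepGen_prodOn_occ {m : ℕ} (α β : ℝ) (b : Bool) (ξ η : Fin (m + 1) → Bool) :
    bdssepGen α β (fun η => prodOn (occ b η) ξ) η
      = dualGen (stateDensity b α) (stateDensity b β) (prodOn (occ b η)) ξ := by
  simp only [bdssepGen, dualGen, rate_mul_prodOn_flip, prodOn_occ_swapConf]

lemma dualGen_sum {m : ℕ} {ι : Type*} (s : Finset ι) (a b : ℝ) (w : ι → ℝ)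
    (f : ι → (Fin (m + 1) → Bool) → ℝ) (ξ : Fin (m + 1) → Bool) :
    dualGen a b (fun ξ => ∑ j ∈ s, w j * f j ξ) ξ = ∑ j ∈ s, w j * dualGen a b (f j) ξ := by
  simp only [dualGen, mul_add, Finset.sum_add_distrib]
  congr 1
  · congr 1
    · simp_rw [Finset.mul_sum]
      rw [Finset.sum_comm]
      refine Finset.sum_congr rfl fun i _ => ?_
      rw [← Finset.sum_sub_distrib, Finset.mul_sum]
      exact Finset.sum_congr rfl fun j _ => by ring
    · split_ifs
      · rw [Finset.mul_sum, ← Finset.sum_sub_distrib, Finset.mul_sum]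
        exact Finset.sum_congr rfl fun j _ => by ring
      · simp
  · split_ifs
    · rw [Finset.mul_sum, ← Finset.sum_sub_distrib, Finset.mul_sum]
      exact Finset.sum_congr rfl fun j _ => by ring
    · simp

lemma dualGen_sub {m : ℕ} (a b : ℝ) (f g : (Fin (m + 1) → Bool) → ℝ)
    (ξ : Fin (m + 1) → Bool) :
    dualGen a b (fun ξ => f ξ - g ξ) ξ = dualGen a b f ξ - dualGen a b g ξ := by
  have h : ∑ i : Fin m, 1 / 2 * (f (swapConf i.castSucc i.succ ξ)
        - g (swapConf i.castSucc i.succ ξ) - (f ξ - g ξ))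
      = ∑ i : Fin m, 1 / 2 * (f (swapConf i.castSucc i.succ ξ) - f ξ)
        - ∑ i : Fin m, 1 / 2 * (g (swapConf i.castSucc i.succ ξ) - g ξ) := by
    rw [← Finset.sum_sub_distrib]
    exact Finset.sum_congr rfl fun i _ => by ring
  simp only [dualGen, h]
  split_ifs <;> ring

/-- The linear profile on `m + 1` sites interpolating between reservoirs `a` and `b`. -/
noncomputable def linProfile (m : ℕ) (a b : ℝ) (x : Fin (m + 1)) : ℝ :=
  a + (b - a) * (((x : ℕ) + 1 : ℝ) / ((m : ℝ) + 2))

lemma linProfile_mem {m : ℕ} {a b : ℝ} (ha : 0 ≤ a) (ha' : a ≤ 1) (hb : 0 ≤ b) (hb' : b ≤ 1)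
    (x : Fin (m + 1)) : 0 ≤ linProfile m a b x ∧ linProfile m a b x ≤ 1 := by
  have hx : ((x : ℕ) : ℝ) ≤ m := by exact_mod_cast Nat.lt_succ_iff.1 x.2
  have h0 : 0 ≤ ((x : ℕ) + 1 : ℝ) / ((m : ℝ) + 2) := by positivity
  have h1 : ((x : ℕ) + 1 : ℝ) / ((m : ℝ) + 2) ≤ 1 := by
    rw [div_le_one (by positivity)]; linarith
  rw [linProfile]
  constructor <;> nlinarith

/-- Products of the linear profile are superharmonic for the dual generator. -/
lemma dualGen_prodOn_linProfile_nonpos {m : ℕ} {a b : ℝ} (ha : 0 ≤ a) (ha' : a ≤ 1)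
    (hb : 0 ≤ b) (hb' : b ≤ 1) (ξ : Fin (m + 1) → Bool) :
    dualGen a b (prodOn (linProfile m a b)) ξ ≤ 0 := by
  set r := linProfile m a b with hr
  set d : ℝ := (b - a) / ((m : ℝ) + 2) with hd
  have hr0 : ∀ x, 0 ≤ r x := fun x => (linProfile_mem ha ha' hb hb' x).1
  have hm : ((m : ℝ) + 2) ≠ 0 := by positivity
  have hstep : ∀ i : Fin m, r i.succ - r i.castSucc = d := fun i => by
    simp only [hr, hd, linProfile, Fin.val_succ, Fin.val_castSucc, Nat.cast_add, Nat.cast_one]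
    field_simp
    ring
  have hfirst : a - r 0 = -d := by
    simp only [hr, hd, linProfile, Fin.val_zero, Nat.cast_zero]
    field_simp
    ring
  have hlast : b - r (Fin.last m) = d := by
    simp only [hr, hd, linProfile, Fin.val_last]
    field_simp
    ring
  set q : Fin (m + 1) → ℝ := fun x =>
    if ξ x then prodOn r (Function.update ξ x false) else 0 with hq
  have hbond : ∀ i : Fin m, 1 / 2 * (prodOn r (swapConf i.castSucc i.succ ξ) - prodOn r ξ)
      ≤ 1 / 2 * d * (q i.castSucc - q i.succ) := by
    intro i
    have hne : i.castSucc ≠ i.succ := (Fin.castSucc_lt_succ).ne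
    by_cases hx : ξ i.castSucc = true <;> by_cases hy : ξ i.succ = true
    · rw [swapConf_eq_self (hx.trans hy.symm)]
      simp only [hq, hx, hy, if_true]
      rw [prodOn_update r (Function.update ξ i.castSucc false) (x := i.succ)
          (by rw [Function.update_of_ne hne.symm, hy]),
        prodOn_update r (Function.update ξ i.succ false) (x := i.castSucc)
          (by rw [Function.update_of_ne hne, hx]),
        Function.update_comm hne, ← sub_mul, hstep]
      have := mul_nonneg (mul_self_nonneg d) (prodOn_nonneg hr0
        (Function.update (Function.update ξ i.succ false) i.castSucc false))
      linarith
    · rw [prodOn_swapConf_sub r ξ hx (by simpa using hy), hstep]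
      simp only [hq, hx, hy, if_true]
      simp [mul_assoc]
    · rw [swapConf_comm, prodOn_swapConf_sub r ξ hy (by simpa using hx),
        show r i.castSucc - r i.succ = -d by rw [← hstep i]; ring]
      simp only [hq, hx, hy, if_true]
      simp [mul_assoc]
    · rw [swapConf_eq_self (by simp_all)]
      simp [hq, hx, hy]
  have htel : ∑ i : Fin m, 1 / 2 * d * (q i.castSucc - q i.succ)
      = 1 / 2 * d * (q 0 - q (Fin.last m)) := by
    rw [← Finset.mul_sum, Finset.sum_sub_distrib]
    have := (Fin.sum_univ_castSucc q).symm.trans (Fin.sum_univ_succ q)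
    congr 1
    linarith
  have hbdry : ∀ (x : Fin (m + 1)) (c : ℝ),
      (if ξ x then 1 / 2 * (c * prodOn r (Function.update ξ x false) - prodOn r ξ) else 0)
        = 1 / 2 * (c - r x) * q x := by
    intro x c
    by_cases hx : ξ x = true
    · rw [if_pos hx, prodOn_update r ξ hx]
      simp only [hq, hx, if_true]
      ring
    · simp [hq, hx]
  rw [dualGen, hbdry, hbdry, hfirst, hlast]
  have := (Finset.sum_le_sum fun i (_ : i ∈ Finset.univ) => hbond i).trans_eq htel
  linarith

/-- Minimum principle for the dual generator. -/
lemma nonneg_of_dualGen_nonpos {m : ℕ} {a b : ℝ} (ha : 0 ≤ a) (ha' : a < 1) (hb : 0 ≤ b)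
    (hb' : b < 1) {f : (Fin (m + 1) → Bool) → ℝ} (hf : ∀ ξ, dualGen a b f ξ ≤ 0)
    (hf0 : f (fun _ => false) = 0) (ξ : Fin (m + 1) → Bool) : 0 ≤ f ξ := by
  by_contra! hneg
  obtain ⟨ξ₀, -, hmin₀⟩ := Finset.exists_min_image Finset.univ f ⟨ξ, Finset.mem_univ _⟩
  have hpos : ∀ x : Fin (m + 1), (0 : ℝ) < (x : ℕ) + 1 := fun x => by positivity
  obtain ⟨ζ, hζ, hζmin⟩ := Finset.exists_min_image
    (Finset.univ.filter fun ζ => f ζ = f ξ₀) (prodOn fun x => ((x : ℕ) + 1 : ℝ)) ⟨ξ₀, by simp⟩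
  simp only [Finset.mem_filter, Finset.mem_univ, true_and] at hζ hζmin
  have hmin : ∀ ξ', f ζ ≤ f ξ' := fun ξ' => hζ ▸ hmin₀ ξ' (Finset.mem_univ _)
  have hζneg : f ζ < 0 := (hmin ξ).trans_lt hneg
  have hswap : ∀ i : Fin m, 0 ≤ 1 / 2 * (f (swapConf i.castSucc i.succ ζ) - f ζ) := fun i => by
    have := hmin (swapConf i.castSucc i.succ ζ)
    linarith
  have hbdry : ∀ (c : ℝ), 0 ≤ c → c < 1 → ∀ ξ', 0 < 1 / 2 * (c * f ξ' - f ζ) :=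
    fun c hc hc' ξ' => by nlinarith [hmin ξ']
  have hleft : 0 ≤ if ζ 0 then 1 / 2 * (a * f (Function.update ζ 0 false) - f ζ) else 0 := by
    split_ifs
    exacts [(hbdry a ha ha' _).le, le_rfl]
  have hright : 0 ≤ if ζ (Fin.last m) then
      1 / 2 * (b * f (Function.update ζ (Fin.last m) false) - f ζ) else 0 := by
    split_ifs
    exacts [(hbdry b hb hb' _).le, le_rfl]
  have hsum := Finset.sum_nonneg fun i (_ : i ∈ Finset.univ) => hswap i
  have hgen := hf ζ
  rw [dualGen] at hgen
  have hempty : ∀ x, ζ x = false := by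
    intro x
    induction x using Fin.induction with
    | zero =>
      by_contra h0
      have h0 : ζ 0 = true := by simpa using h0
      rw [if_pos h0] at hgen
      linarith [hbdry a ha ha' (Function.update ζ 0 false)]
    | succ i ih =>
      by_contra h1
      have h1 : ζ i.succ = true := by simpa using h1
      have hz : 1 / 2 * (f (swapConf i.castSucc i.succ ζ) - f ζ) ≤ 0 :=
        (Finset.single_le_sum (fun i _ => hswap i) (Finset.mem_univ i)).trans (by linarith)
      have heq : f (swapConf i.castSucc i.succ ζ) = f ξ₀ := by
        have := hmin (swapConf i.castSucc i.succ ζ)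
        linarith
      have hle := hζmin _ heq
      have hsub := prodOn_swapConf_sub (fun x : Fin (m + 1) => ((x : ℕ) + 1 : ℝ)) ζ h1 ih
      rw [swapConf_comm] at hsub
      have hP : 0 < prodOn (fun x : Fin (m + 1) => ((x : ℕ) + 1 : ℝ))
          (Function.update ζ i.succ false) :=
        Finset.prod_pos fun x _ => by split_ifs; exacts [hpos x, one_pos]
      simp only [Fin.val_succ, Fin.val_castSucc, Nat.cast_add, Nat.cast_one] at hsub
      linarith
  rw [funext hempty, hf0] at hζneg
  exact hζneg.false

/-- Correlations of the stationary state are dominated by those of the product measure. -/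
lemma sum_mul_prodOn_occ_le {m : ℕ} {α β : ℝ} (hα : 0 < α) (hα' : α < 1) (hβ : 0 < β)
    (hβ' : β < 1) {ν : (Fin (m + 1) → Bool) → ℝ} (hν : ∑ η, ν η = 1)
    (hstat : ∀ h, ∑ η, ν η * bdssepGen α β h η = 0) (b : Bool) (ξ : Fin (m + 1) → Bool) :
    ∑ η, ν η * prodOn (occ b η) ξ
      ≤ prodOn (linProfile m (stateDensity b α) (stateDensity b β)) ξ := by
  have hd : ∀ {r : ℝ}, 0 < r → r < 1 → 0 < stateDensity b r ∧ stateDensity b r < 1 := by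
    intro r h0 h1
    cases b <;> simp [stateDensity] <;> constructor <;> linarith
  obtain ⟨ha, ha'⟩ := hd hα hα'
  obtain ⟨hb, hb'⟩ := hd hβ hβ'
  refine sub_nonneg.1 (nonneg_of_dualGen_nonpos ha.le ha' hb.le hb'
    (f := fun ξ => prodOn (linProfile m (stateDensity b α) (stateDensity b β)) ξ
      - ∑ η, ν η * prodOn (occ b η) ξ) (fun ξ => ?_) ?_ ξ)
  · rw [dualGen_sub, dualGen_sum]
    simp_rw [← bdssepGen_prodOn_occ]
    rw [hstat, sub_zero]
    exact dualGen_prodOn_linProfile_nonpos ha.le ha'.le hb.le hb'.le ξ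
  · simp [prodOn, hν]

/-! ### Exponential concentration -/

/-- Chernoff bound for variables whose correlations are dominated by those of an independent
family. -/
lemma sum_ite_le_exp_of_prodOn_le {n N : ℕ} {ν : (Fin n → Bool) → ℝ} (hν : ∀ η, 0 ≤ ν η)
    {b : Bool} {p : Fin n → ℝ} (hp : ∀ x, 0 ≤ p x ∧ p x ≤ 1)
    (hcor : ∀ ξ, ∑ η, ν η * prodOn (occ b η) ξ ≤ prodOn p ξ) (hn : n ≤ N)
    {u : Fin n → ℝ} (hu : ∀ x, 0 ≤ u x ∧ N * u x ≤ 1) {ε : ℝ} (hε : 0 < ε) (hε2 : ε ≤ 2) :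
    ∑ η, (if ε ≤ ∑ x, u x * (occ b η x - p x) then ν η else 0)
      ≤ Real.exp (-(ε ^ 2 / 4 * N)) := by
  set t : Fin n → ℝ := fun x => ε / 2 * (N * u x) with ht
  have ht0 : ∀ x, 0 ≤ t x := fun x => by have := (hu x).1; positivity
  have htε : ∀ x, t x ≤ ε / 2 := fun x => by
    have := (hu x).2; simp only [ht]; nlinarith
  have hc0 : ∀ x, 0 ≤ Real.exp (t x) - 1 := fun x => by
    have := Real.add_one_le_exp (t x); linarith [ht0 x]
  have hexpand : ∀ y : Fin n → ℝ, ∏ x, (1 + (Real.exp (t x) - 1) * y x)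
      = ∑ A : Finset (Fin n), (∏ x ∈ A, (Real.exp (t x) - 1))
          * prodOn y (fun x => decide (x ∈ A)) := by
    intro y
    rw [Finset.prod_one_add, Finset.powerset_univ]
    refine Finset.sum_congr rfl fun A _ => ?_
    rw [Finset.prod_mul_distrib, prodOn]
    simp [Finset.prod_ite_mem]
  have hmgf : ∑ η, ν η * ∏ x, (1 + (Real.exp (t x) - 1) * occ b η x)
      ≤ ∏ x, (1 + (Real.exp (t x) - 1) * p x) := by
    simp_rw [hexpand, Finset.mul_sum]
    rw [Finset.sum_comm]
    refine Finset.sum_le_sum fun A _ => ?_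
    have h := mul_le_mul_of_nonneg_left (hcor fun x => decide (x ∈ A))
      (Finset.prod_nonneg fun x (_ : x ∈ A) => hc0 x)
    rw [Finset.mul_sum] at h
    refine le_trans (le_of_eq ?_) h
    exact Finset.sum_congr rfl fun η _ => by ring
  have hfactor : ∏ x, (1 + (Real.exp (t x) - 1) * p x)
      ≤ Real.exp (∑ x, t x * p x + ε ^ 2 / 4 * N) := by
    calc _ ≤ ∏ x, Real.exp (t x * p x + ε ^ 2 / 4) := by
          refine Finset.prod_le_prod (fun x _ => ?_) fun x _ => ?_
          · have := mul_nonneg (hc0 x) (hp x).1; linarith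
          · have h1 : |t x| ≤ 1 := by rw [abs_of_nonneg (ht0 x)]; linarith [htε x]
            have h2 := (abs_le.1 (Real.abs_exp_sub_one_sub_id_le h1)).2
            have h3 : t x ^ 2 ≤ ε ^ 2 / 4 := by nlinarith [ht0 x, htε x]
            have h4 := Real.add_one_le_exp (t x * p x + ε ^ 2 / 4)
            have h5 : (Real.exp (t x) - 1 - t x) * p x ≤ ε ^ 2 / 4 := by
              nlinarith [(hp x).1, (hp x).2, sq_nonneg ε]
            linarith
      _ = Real.exp (∑ x, t x * p x + n * (ε ^ 2 / 4)) := by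
          rw [← Real.exp_sum, Finset.sum_add_distrib]; simp
      _ ≤ _ := by
          have : (n : ℝ) ≤ N := by exact_mod_cast hn
          have := mul_le_mul_of_nonneg_right this (by positivity : 0 ≤ ε ^ 2 / 4)
          exact Real.exp_le_exp.2 (by linarith)
  have hexp : ∀ η, Real.exp (∑ x, t x * occ b η x)
      = ∏ x, (1 + (Real.exp (t x) - 1) * occ b η x) := by
    intro η
    rw [Real.exp_sum]
    refine Finset.prod_congr rfl fun x _ => ?_
    simp only [occ]
    split_ifs <;> simp
  have hmarkov : ∀ η, (if ε ≤ ∑ x, u x * (occ b η x - p x) then ν η else 0)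
      ≤ Real.exp (-(∑ x, t x * p x) - ε ^ 2 / 2 * N)
        * (ν η * ∏ x, (1 + (Real.exp (t x) - 1) * occ b η x)) := by
    intro η
    rw [← hexp, mul_left_comm, ← Real.exp_add]
    split_ifs with h
    · refine le_mul_of_one_le_right (hν η) (Real.one_le_exp ?_)
      have h1 : ∑ x, t x * occ b η x - ∑ x, t x * p x
          = ε / 2 * N * ∑ x, u x * (occ b η x - p x) := by
        rw [← Finset.sum_sub_distrib, Finset.mul_sum]
        exact Finset.sum_congr rfl fun x _ => by simp only [ht]; ring
      have h2 : ε / 2 * N * ε ≤ ε / 2 * N * ∑ x, u x * (occ b η x - p x) :=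
        mul_le_mul_of_nonneg_left h (by positivity)
      linarith
    · exact mul_nonneg (hν η) (Real.exp_pos _).le
  calc _ ≤ _ := Finset.sum_le_sum fun η _ => hmarkov η
    _ ≤ Real.exp (-(∑ x, t x * p x) - ε ^ 2 / 2 * N)
        * Real.exp (∑ x, t x * p x + ε ^ 2 / 4 * N) := by
        rw [← Finset.mul_sum]
        exact mul_le_mul_of_nonneg_left (hmgf.trans hfactor) (Real.exp_pos _).le
    _ = _ := by rw [← Real.exp_add]; congr 1; ring

/-- Two-sided concentration in the stationary state for linear statistics with weights of
order `1 / N`. -/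
lemma sum_ite_abs_le_exp {m : ℕ} {α β : ℝ} (hα : 0 < α) (hα' : α < 1) (hβ : 0 < β)
    (hβ' : β < 1) {ν : (Fin (m + 1) → Bool) → ℝ} (hν0 : ∀ η, 0 ≤ ν η) (hν : ∑ η, ν η = 1)
    (hstat : ∀ h, ∑ η, ν η * bdssepGen α β h η = 0)
    {N : ℕ} (hN : m + 1 ≤ N) {w : Fin (m + 1) → ℝ} (hw : ∀ x, N * |w x| ≤ 1)
    {ε : ℝ} (hε : 0 < ε) (hε4 : ε ≤ 4) :
    ∑ η, (if ε ≤ |∑ x, w x * (occ true η x - linProfile m α β x)| then ν η else 0)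
      ≤ 4 * Real.exp (-(ε ^ 2 / 16 * N)) := by
  have hlin : ∀ x, linProfile m (stateDensity false α) (stateDensity false β) x
      = 1 - linProfile m α β x := fun x => by simp [linProfile, stateDensity]; ring
  have hocc : ∀ (η : Fin (m + 1) → Bool) x, occ false η x = 1 - occ true η x := fun η x => by
    cases h : η x <;> simp [occ, h]
  have hd : ∀ (b : Bool) {r : ℝ}, 0 < r → r < 1 →
      0 ≤ stateDensity b r ∧ stateDensity b r ≤ 1 := by
    intro b r h0 h1
    cases b <;> simp [stateDensity] <;> constructor <;> linarith
  have key : ∀ (b : Bool) (u : Fin (m + 1) → ℝ), (∀ x, 0 ≤ u x ∧ N * u x ≤ 1) →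
      ∑ η, (if ε / 2 ≤ ∑ x, u x * (occ b η x
          - linProfile m (stateDensity b α) (stateDensity b β) x) then ν η else 0)
        ≤ Real.exp (-(ε ^ 2 / 16 * N)) := fun b u hu => by
    have h := sum_ite_le_exp_of_prodOn_le hν0
      (fun x => linProfile_mem (hd b hα hα').1 (hd b hα hα').2 (hd b hβ hβ').1 (hd b hβ hβ').2 x)
      (sum_mul_prodOn_occ_le hα hα' hβ hβ' hν hstat b) hN hu
      (ε := ε / 2) (by linarith) (by linarith)
    convert h using 3
    ring
  have hu : ∀ w' : Fin (m + 1) → ℝ, (∀ x, |w' x| = |w x|) →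
      ∀ x, 0 ≤ max (w' x) 0 ∧ N * max (w' x) 0 ≤ 1 := fun w' hw' x => by
    refine ⟨le_max_right _ _, le_trans ?_ (hw x)⟩
    rw [← hw']
    exact mul_le_mul_of_nonneg_left (max_le (le_abs_self _) (abs_nonneg _)) (Nat.cast_nonneg _)
  have hplus := hu w fun _ => rfl
  have hminus := hu (fun x => -w x) fun x => abs_neg _
  have h1 := key true _ hplus
  have h2 := key false _ hminus
  have h3 := key true _ hminus
  have h4 := key false _ hplus
  simp only [stateDensity, if_true] at h1 h3
  simp only [hlin, hocc] at h2 h4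
  refine le_trans ?_ ((add_le_add (add_le_add h1 h2) (add_le_add h3 h4)).trans_eq (by ring))
  simp only [← Finset.sum_add_distrib]
  refine Finset.sum_le_sum fun η _ => ?_
  set y : Fin (m + 1) → ℝ := fun x => occ true η x - linProfile m α β x with hy
  have hneg : ∀ x, 1 - occ true η x - (1 - linProfile m α β x) = -y x := fun x => by
    simp only [hy]; ring
  have hpos : ∀ x, occ true η x - linProfile m α β x = y x := fun _ => rfl
  simp only [hneg, hpos, mul_neg, Finset.sum_neg_distrib]
  have hsplit : ∑ x, w x * y x = ∑ x, max (w x) 0 * y x - ∑ x, max (-w x) 0 * y x := by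
    rw [← Finset.sum_sub_distrib]
    refine Finset.sum_congr rfl fun x _ => ?_
    rw [← sub_mul]
    congr 1
    rcases le_total (w x) 0 with h | h
    · rw [max_eq_right h, max_eq_left (by linarith)]; ring
    · rw [max_eq_left h, max_eq_right (by linarith)]; ring
  have := hν0 η
  rw [hsplit]
  set S₁ := ∑ x, max (w x) 0 * y x
  set S₂ := ∑ x, max (-w x) 0 * y x
  by_cases hbig : ε ≤ |S₁ - S₂|
  · rw [if_pos hbig]
    rcases le_abs.1 hbig with h | h
    · rcases le_or_gt (ε / 2) S₁ with h' | h'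
      · rw [if_pos h']; split_ifs <;> linarith
      · rw [if_pos (by linarith : ε / 2 ≤ -S₂)]; split_ifs <;> linarith
    · rcases le_or_gt (ε / 2) S₂ with h' | h'
      · rw [if_pos h']; split_ifs <;> linarith
      · rw [if_pos (by linarith : ε / 2 ≤ -S₁)]; split_ifs <;> linarith
  · rw [if_neg hbig]
    split_ifs <;> linarith

/-! ### Pairings with test functions -/

/-- The left end of the cell of site `i + 1`. -/
noncomputable def cellEnd (m i : ℕ) : ℝ := ((i : ℝ) + 1 / 2) / ((m : ℝ) + 2)

lemma cellEnd_pos (m i : ℕ) : 0 < cellEnd m i := by unfold cellEnd; positivity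

lemma cellEnd_succ_sub (m i : ℕ) : cellEnd m (i + 1) - cellEnd m i = 1 / ((m : ℝ) + 2) := by
  unfold cellEnd; push_cast; field_simp; ring

lemma cellEnd_le_succ (m i : ℕ) : cellEnd m i ≤ cellEnd m (i + 1) := by
  have : 0 < 1 / ((m : ℝ) + 2) := by positivity
  linarith [cellEnd_succ_sub m i]

lemma cellEnd_le_one {m i : ℕ} (hi : i ≤ m + 1) : cellEnd m i ≤ 1 := by
  have : (i : ℝ) ≤ m + 1 := by exact_mod_cast hi
  rw [cellEnd, div_le_one (by positivity)]
  linarith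

/-- The weight of site `i + 1` in the pairing of an empirical profile with `G`. -/
noncomputable def cellWeight (m : ℕ) (G : ℝ → ℝ) (i : ℕ) : ℝ :=
  ∫ x in cellEnd m i..cellEnd m (i + 1), G x

lemma abs_cellWeight_le (m : ℕ) {G : ℝ → ℝ} (hG : ∀ x, |G x| ≤ 1) (i : ℕ) :
    ((m + 2 : ℕ) : ℝ) * |cellWeight m G i| ≤ 1 := by
  have h := intervalIntegral.norm_integral_le_of_norm_le_const
    (a := cellEnd m i) (b := cellEnd m (i + 1)) (f := G) (C := 1) fun x _ => hG x
  rw [cellEnd_succ_sub, one_mul, abs_of_nonneg (by positivity), Real.norm_eq_abs] at h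
  rw [cellWeight]
  push_cast
  calc _ ≤ ((m : ℝ) + 2) * (1 / ((m : ℝ) + 2)) := by gcongr
    _ = 1 := by field_simp

lemma pairing_empProfile (m : ℕ) {G : ℝ → ℝ} (hG : Continuous G) (η : Config (m + 2)) :
    pairing (empProfile (m + 2) η) G
      = ∑ i : Fin (m + 1), cellWeight m G i * occ true (n := m + 1) η i := by
  have hcell : ∀ (i : Fin (m + 1)) (x : ℝ),
      (((i : ℕ) + 1 : ℝ) / ((m + 2 : ℕ) : ℝ) - 1 / (2 * ((m + 2 : ℕ) : ℝ)) ≤ x ∧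
        x < ((i : ℕ) + 1 : ℝ) / ((m + 2 : ℕ) : ℝ) + 1 / (2 * ((m + 2 : ℕ) : ℝ)))
      ↔ x ∈ Set.Ico (cellEnd m i) (cellEnd m (i + 1)) := by
    intro i x
    have h1 : ((i : ℕ) + 1 : ℝ) / ((m + 2 : ℕ) : ℝ) - 1 / (2 * ((m + 2 : ℕ) : ℝ))
        = cellEnd m i := by
      unfold cellEnd; push_cast; field_simp; ring
    have h2 : ((i : ℕ) + 1 : ℝ) / ((m + 2 : ℕ) : ℝ) + 1 / (2 * ((m + 2 : ℕ) : ℝ))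
        = cellEnd m (i + 1) := by
      unfold cellEnd; push_cast; field_simp
    rw [h1, h2, Set.mem_Ico]
  have hemp : ∀ x, empProfile (m + 2) η x * G x = ∑ i : Fin (m + 1),
      occ true (n := m + 1) η i * (Set.Ico (cellEnd m i) (cellEnd m (i + 1))).indicator G x := by
    intro x
    rw [empProfile, Finset.sum_mul]
    refine Finset.sum_congr rfl fun i _ => ?_
    simp only [hcell i x]
    by_cases h1 : η i = true <;>
      by_cases h2 : x ∈ Set.Ico (cellEnd m i) (cellEnd m (i + 1)) <;> simp [occ, h1, h2]
  have hint : ∀ i : Fin (m + 1), IntervalIntegrable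
      ((Set.Ico (cellEnd m i) (cellEnd m (i + 1))).indicator G) volume 0 1 := fun i => by
    rw [intervalIntegrable_iff]
    exact (intervalIntegrable_iff.1 (hG.intervalIntegrable 0 1)).indicator measurableSet_Ico
  have hval : ∀ i : Fin (m + 1),
      ∫ x in (0 : ℝ)..1, (Set.Ico (cellEnd m i) (cellEnd m (i + 1))).indicator G x
        = cellWeight m G i := fun i => by
    rw [intervalIntegral.integral_of_le zero_le_one, setIntegral_indicator measurableSet_Ico,
      Set.inter_eq_self_of_subset_right, integral_Ico_eq_integral_Ioc, cellWeight,
      intervalIntegral.integral_of_le (cellEnd_le_succ m i)]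
    exact fun x hx => ⟨(cellEnd_pos m i).trans_le hx.1,
      (hx.2.trans_le (cellEnd_le_one (Nat.succ_le_succ (Nat.lt_succ_iff.1 i.2)))).le⟩
  rw [pairing]
  simp_rw [hemp]
  rw [intervalIntegral.integral_finsetSum fun i _ => (hint i).const_mul _]
  refine Finset.sum_congr rfl fun i _ => ?_
  rw [intervalIntegral.integral_const_mul, hval, mul_comm]

/-- A Riemann sum estimate for the pairing of the stationary profile. -/
lemma abs_pairing_rhoBar_sub_le (m : ℕ) {α β : ℝ} (hα : 0 ≤ α) (hαβ : α ≤ β) (hβ : β ≤ 1)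
    {G : ℝ → ℝ} (hG : Continuous G) (hG1 : ∀ x, |G x| ≤ 1) :
    |pairing (rhoBar α β) G - ∑ i : Fin (m + 1), cellWeight m G i * linProfile m α β i|
      ≤ 2 / ((m : ℝ) + 2) := by
  have hcont : Continuous fun x => rhoBar α β x * G x := by unfold rhoBar; fun_prop
  have hii : ∀ a b : ℝ, IntervalIntegrable (fun x => rhoBar α β x * G x) volume a b :=
    fun a b => hcont.intervalIntegrable a b
  have hρ : ∀ x ∈ Set.Icc (0 : ℝ) 1, |rhoBar α β x * G x| ≤ 1 := fun x hx => by
    rw [abs_mul]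
    refine mul_le_one₀ (abs_le.2 ?_) (abs_nonneg _) (hG1 x)
    unfold rhoBar
    constructor <;> nlinarith [hx.1, hx.2]
  have h0 : cellEnd m 0 = 1 / 2 * (1 / ((m : ℝ) + 2)) := by unfold cellEnd; push_cast; ring
  have h1 : 1 - cellEnd m (m + 1) = 1 / 2 * (1 / ((m : ℝ) + 2)) := by
    unfold cellEnd; push_cast; field_simp; ring
  have hleft : |∫ x in (0 : ℝ)..cellEnd m 0, rhoBar α β x * G x| ≤ 1 / 2 * (1 / ((m : ℝ) + 2)) := by
    have h := intervalIntegral.norm_integral_le_of_norm_le_const (a := 0) (b := cellEnd m 0)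
      (f := fun x => rhoBar α β x * G x) (C := 1) fun x hx => by
        rw [Set.uIoc_of_le (cellEnd_pos m 0).le] at hx
        exact hρ x ⟨hx.1.le, hx.2.trans (cellEnd_le_one (Nat.zero_le _))⟩
    rw [one_mul, sub_zero, abs_of_pos (cellEnd_pos m 0)] at h
    exact h.trans_eq h0
  have hright : |∫ x in cellEnd m (m + 1)..1, rhoBar α β x * G x|
      ≤ 1 / 2 * (1 / ((m : ℝ) + 2)) := by
    have h := intervalIntegral.norm_integral_le_of_norm_le_const (a := cellEnd m (m + 1)) (b := 1)
      (f := fun x => rhoBar α β x * G x) (C := 1) fun x hx => by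
        rw [Set.uIoc_of_le (cellEnd_le_one le_rfl)] at hx
        exact hρ x ⟨((cellEnd_pos m _).trans hx.1).le, hx.2⟩
    rwa [one_mul, h1, abs_of_nonneg (by positivity)] at h
  have hmid : ∀ i : Fin (m + 1), |(∫ x in cellEnd m i..cellEnd m (i + 1), rhoBar α β x * G x)
      - cellWeight m G i * linProfile m α β i| ≤ (1 / ((m : ℝ) + 2)) ^ 2 := by
    intro i
    rw [cellWeight, mul_comm, ← intervalIntegral.integral_const_mul,
      ← intervalIntegral.integral_sub (hii _ _) ((hG.const_mul _).intervalIntegrable _ _)]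
    have h := intervalIntegral.norm_integral_le_of_norm_le_const
      (a := cellEnd m i) (b := cellEnd m (i + 1)) (C := 1 / ((m : ℝ) + 2))
      (f := fun x => rhoBar α β x * G x - linProfile m α β i * G x) fun x hx => by
        rw [Set.uIoc_of_le (cellEnd_le_succ m i)] at hx
        rw [← sub_mul, norm_mul]
        refine (mul_le_of_le_one_right (norm_nonneg _) (hG1 x)).trans ?_
        have hd : rhoBar α β x - linProfile m α β i
            = (β - α) * (x - ((i : ℕ) + 1 : ℝ) / ((m : ℝ) + 2)) := by
          unfold rhoBar linProfile; ring
        rw [hd, norm_mul]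
        have hβα : ‖β - α‖ ≤ 1 := by
          rw [Real.norm_eq_abs, abs_le]; constructor <;> linarith
        refine (mul_le_of_le_one_left (norm_nonneg _) hβα).trans ?_
        have e1 : ((i : ℕ) + 1 : ℝ) / ((m : ℝ) + 2)
            = cellEnd m i + 1 / 2 * (1 / ((m : ℝ) + 2)) := by
          unfold cellEnd; field_simp; ring
        have e2 := cellEnd_succ_sub m i
        have e3 : 0 < 1 / ((m : ℝ) + 2) := by positivity
        rw [e1, Real.norm_eq_abs, abs_le]
        constructor <;> linarith [hx.1, hx.2]
    rwa [cellEnd_succ_sub, abs_of_nonneg (by positivity), ← sq] at h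
  have hsum : ∫ x in cellEnd m 0..cellEnd m (m + 1), rhoBar α β x * G x
      = ∑ i : Fin (m + 1), ∫ x in cellEnd m i..cellEnd m (i + 1), rhoBar α β x * G x := by
    rw [← intervalIntegral.sum_integral_adjacent_intervals (fun k _ => hii _ _),
      Finset.sum_range]
  have hsplit : pairing (rhoBar α β) G = (∫ x in (0 : ℝ)..cellEnd m 0, rhoBar α β x * G x)
      + (∑ i : Fin (m + 1), ∫ x in cellEnd m i..cellEnd m (i + 1), rhoBar α β x * G x)
      + ∫ x in cellEnd m (m + 1)..1, rhoBar α β x * G x := by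
    rw [← hsum, intervalIntegral.integral_add_adjacent_intervals (hii _ _) (hii _ _),
      intervalIntegral.integral_add_adjacent_intervals (hii _ _) (hii _ _), pairing]
  have hmidsum : |∑ i : Fin (m + 1), ((∫ x in cellEnd m i..cellEnd m (i + 1), rhoBar α β x * G x)
      - cellWeight m G i * linProfile m α β i)| ≤ 1 / ((m : ℝ) + 2) := by
    refine (Finset.abs_sum_le_sum_abs _ _).trans
      ((Finset.sum_le_sum fun i _ => hmid i).trans ?_)
    simp only [Finset.sum_const, Finset.card_univ, Fintype.card_fin, nsmul_eq_mul]
    push_cast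
    rw [div_pow, one_pow, mul_one_div, div_le_div_iff₀ (by positivity) (by positivity)]
    nlinarith
  rw [Finset.sum_sub_distrib] at hmidsum
  have e : 2 / ((m : ℝ) + 2) = 2 * (1 / ((m : ℝ) + 2)) := by ring
  rw [hsplit, e]
  rw [abs_le] at *
  constructor <;> linarith [hleft.1, hleft.2, hright.1, hright.2, hmidsum.1, hmidsum.2]

lemma abs_pairing_le_one {γ G : ℝ → ℝ} (hγ : memM γ) (hG : ∀ x, |G x| ≤ 1) :
    |pairing γ G| ≤ 1 := by
  have h := intervalIntegral.norm_integral_le_of_norm_le_const (a := (0 : ℝ)) (b := 1)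
    (f := fun x => γ x * G x) (C := 1) fun x hx => by
      rw [Set.uIoc_of_le zero_le_one] at hx
      obtain ⟨h0, h1⟩ := hγ x ⟨hx.1.le, hx.2⟩
      rw [norm_mul]
      exact mul_le_one₀ (abs_le.2 ⟨by linarith, h1⟩) (norm_nonneg _) (hG x)
  rwa [sub_zero, abs_one, one_mul, Real.norm_eq_abs] at h

/-- If two profiles are at distance at least `δ`, one of the first `K` test functions, with `K`
depending only on `δ`, separates them. -/
lemma exists_le_abs_pairing_sub {δ : ℝ} {K : ℕ} (hK : (1 / 2 : ℝ) ^ K < δ / 4)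
    {F : ℕ → ℝ → ℝ} (hF : ∀ k x, |F k x| ≤ 1) {γ γ' : ℝ → ℝ} (hγ : memM γ) (hγ' : memM γ')
    (h : δ ≤ profDist F γ γ') :
    ∃ k < K, δ / 2 ≤ |pairing γ (F k) - pairing γ' (F k)| := by
  by_contra! hlt
  have hbd : ∀ k, |pairing γ (F k) - pairing γ' (F k)| ≤ 2 := fun k => by
    have h1 := abs_le.1 (abs_pairing_le_one hγ (hF k))
    have h2 := abs_le.1 (abs_pairing_le_one hγ' (hF k))
    rw [abs_le]; constructor <;> linarith [h1.1, h1.2, h2.1, h2.2]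
  have hgeo : HasSum (fun k : ℕ => (1 / 2 : ℝ) ^ (k + 1)) 1 := by
    have := hasSum_geometric_two.mul_left (1 / 2 : ℝ)
    simpa [pow_succ, mul_comm] using this
  have hs : Summable fun k : ℕ =>
      (1 / 2 : ℝ) ^ (k + 1) * |pairing γ (F k) - pairing γ' (F k)| :=
    Summable.of_nonneg_of_le (fun k => by positivity)
      (fun k => mul_le_mul_of_nonneg_left (hbd k) (by positivity)) (hgeo.summable.mul_right 2)
  have hδ : 0 < δ := by linarith [pow_pos (by norm_num : (0 : ℝ) < 1 / 2) K]
  have hhead : ∑ k ∈ Finset.range K,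
      (1 / 2 : ℝ) ^ (k + 1) * |pairing γ (F k) - pairing γ' (F k)| ≤ δ / 2 := by
    calc _ ≤ ∑ k ∈ Finset.range K, (1 / 2 : ℝ) ^ (k + 1) * (δ / 2) :=
          Finset.sum_le_sum fun k hk => mul_le_mul_of_nonneg_left
            (hlt k (Finset.mem_range.1 hk)).le (by positivity)
      _ ≤ δ / 2 := by
          rw [← Finset.sum_mul]
          have := sum_le_hasSum (Finset.range K) (fun k _ => by positivity) hgeo
          nlinarith
  have htail : ∑' k, (1 / 2 : ℝ) ^ (k + K + 1) * |pairing γ (F (k + K)) - pairing γ' (F (k + K))|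
      ≤ (1 / 2 : ℝ) ^ K * 2 := by
    have hg := (hgeo.mul_left ((1 / 2 : ℝ) ^ K)).mul_right 2
    rw [mul_one] at hg
    refine hasSum_le (fun k => ?_) ((summable_nat_add_iff K).2 hs).hasSum hg
    refine (mul_le_mul_of_nonneg_left (hbd (k + K)) (by positivity)).trans_eq ?_
    ring
  rw [profDist, ← hs.sum_add_tsum_nat_add K] at h
  linarith

/-- Exponential bound for the probability of being far from the stationary profile. -/
lemma nuSet_empProfile_le {m : ℕ} {α β : ℝ} (hα : 0 < α) (hαβ : α ≤ β) (hβ : β < 1)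
    (c : CTMC (Config (m + 2))) (hR : c.R = bdssepR (m + 2) α β)
    {F : ℕ → ℝ → ℝ} (hFcont : ∀ k, Continuous (F k)) (hFbd : ∀ k x, |F k x| ≤ 1)
    {O : Set (ℝ → ℝ)} (hOM : ∀ γ ∈ O, memM γ) {δ : ℝ} (hδ : 0 < δ) (hδ1 : δ ≤ 1)
    (hdist : ∀ γ ∈ O, δ ≤ profDist F (rhoBar α β) γ)
    {K : ℕ} (hK : (1 / 2 : ℝ) ^ K < δ / 4) (hm : 2 / ((m : ℝ) + 2) ≤ δ / 4) :
    c.nuSet {η | empProfile (m + 2) η ∈ O}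
      ≤ K * (4 * Real.exp (-((δ / 4) ^ 2 / 16 * (m + 2 : ℕ)))) := by
  have hstat : ∀ h, ∑ η, c.ν η * bdssepGen (m := m) α β h η = 0 := fun h => by
    rw [← c.sum_nu_mul_generator h, hR]
    simp_rw [sum_bdssepR_mul]
  have hconc := fun k => sum_ite_abs_le_exp hα (hαβ.trans_lt hβ) (hα.trans_le hαβ) hβ
    (fun η => (c.ν_pos η).le) c.ν_sum hstat (N := m + 2) (by omega)
    (w := fun x : Fin (m + 1) => cellWeight m (F k) x)
    (fun x => abs_cellWeight_le m (hFbd k) x) (ε := δ / 4) (by linarith) (by linarith)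
  have hρ : memM (rhoBar α β) := fun x hx => by
    unfold rhoBar; constructor <;> nlinarith [hx.1, hx.2]
  calc c.nuSet {η | empProfile (m + 2) η ∈ O}
      ≤ ∑ η : Config (m + 2), ∑ k ∈ Finset.range K, (if δ / 4 ≤ |∑ x : Fin (m + 1),
          cellWeight m (F k) x * (occ true (n := m + 1) η x - linProfile m α β x)|
            then c.ν η else 0) := by
        refine Finset.sum_le_sum fun η _ => ?_
        have hnn : ∀ k, 0 ≤ (if δ / 4 ≤ |∑ x : Fin (m + 1),
            cellWeight m (F k) x * (occ true (n := m + 1) η x - linProfile m α β x)|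
              then c.ν η else 0) := fun k => by
          split_ifs; exacts [(c.ν_pos η).le, le_rfl]
        by_cases hη : empProfile (m + 2) η ∈ O
        · rw [Set.indicator_of_mem (show η ∈ {η | empProfile (m + 2) η ∈ O} from hη)]
          obtain ⟨k, hk, hkδ⟩ := exists_le_abs_pairing_sub hK hFbd hρ (hOM _ hη) (hdist _ hη)
          refine le_trans (le_of_eq ?_)
            (Finset.single_le_sum (fun k _ => hnn k) (Finset.mem_range.2 hk))
          rw [if_pos]
          have h1 := abs_pairing_rhoBar_sub_le m hα.le hαβ hβ.le (hFcont k) (hFbd k)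
          rw [pairing_empProfile m (hFcont k), abs_sub_comm] at hkδ
          simp only [mul_sub, Finset.sum_sub_distrib]
          have h2 := abs_sub_le (∑ x : Fin (m + 1), cellWeight m (F k) x * occ true (n := m + 1) η x)
            (∑ x : Fin (m + 1), cellWeight m (F k) x * linProfile m α β x)
            (pairing (rhoBar α β) (F k))
          rw [abs_sub_comm] at h1
          linarith
        · rw [Set.indicator_of_notMem (show η ∉ {η | empProfile (m + 2) η ∈ O} from hη)]
          exact Finset.sum_nonneg fun k _ => hnn k
    _ ≤ ∑ k ∈ Finset.range K, 4 * Real.exp (-((δ / 4) ^ 2 / 16 * (m + 2 : ℕ))) := by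
        rw [Finset.sum_comm]
        exact Finset.sum_le_sum fun k _ => hconc k
    _ = _ := by simp

/-- **Lemma 4.7.** For the BDSSEP and an open subset `𝒪` of `ℳ` with
`d(ρ̄, 𝒪) > 0`, setting `A_N = {η : π^N(η) ∈ 𝒪}`, there exists `a > 0` such that, for
all `N` large enough, `r_N(A_Nᶜ, A_N) ≤ e^{−aN}` and `ν^N_{α,β}(A_N) ≤ e^{−aN}`. -/
theorem bdssep_avgRate_and_measure_exponentially_small
    (α β : ℝ) (hα : 0 < α) (hαβ : α ≤ β) (hβ : β < 1)
    (chain : ∀ N : ℕ, CTMC (Config N))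
    (hR : ∀ N, (chain N).R = bdssepR N α β)
    (F : ℕ → ℝ → ℝ) (hFcont : ∀ k, Continuous (F k)) (hFbd : ∀ k x, |F k x| ≤ 1)
    (O : Set (ℝ → ℝ)) (hOM : ∀ γ ∈ O, memM γ) (hOopen : dOpen F O)
    (hdist : ∃ δ > 0, ∀ γ ∈ O, δ ≤ profDist F (rhoBar α β) γ) :
    ∃ a > (0 : ℝ), ∀ᶠ N : ℕ in atTop,
      (chain N).avgRate {η | empProfile N η ∈ O} ≤ Real.exp (-(a * N)) ∧
      (chain N).nuSet {η | empProfile N η ∈ O} ≤ Real.exp (-(a * N)) := by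
  obtain ⟨δ₀, hδ₀, hdist⟩ := hdist
  set δ := min δ₀ 1 with hδdef
  have hδ : 0 < δ := lt_min hδ₀ one_pos
  have hδ1 : δ ≤ 1 := min_le_right _ _
  obtain ⟨K, hK⟩ := exists_pow_lt_of_lt_one (by linarith : 0 < δ / 4)
    (by norm_num : (1 / 2 : ℝ) < 1)
  have ha : 0 < (δ / 4) ^ 2 / 32 := by positivity
  refine ⟨(δ / 4) ^ 2 / 32, ha, ?_⟩
  set a := (δ / 4) ^ 2 / 32 with hadef
  have hdecay : Tendsto (fun N : ℕ => 28 * K / a ^ 2 * ((a * N) ^ 2 * Real.exp (-(a * N))))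
      atTop (𝓝 (28 * K / a ^ 2 * 0)) :=
    ((Real.tendsto_pow_mul_exp_neg_atTop_nhds_zero 2).comp
      (tendsto_natCast_atTop_atTop.const_mul_atTop ha)).const_mul _
  rw [mul_zero] at hdecay
  filter_upwards [hdecay.eventually_lt_const (by norm_num : (0 : ℝ) < 1 / 2),
    eventually_ge_atTop 2, tendsto_natCast_atTop_atTop.eventually_ge_atTop (8 / δ)]
    with N hN hN2 hNδ
  obtain ⟨m, rfl⟩ : ∃ m, N = m + 2 := ⟨N - 2, by omega⟩
  have hα' : α < 1 := hαβ.trans_lt hβ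
  have hm : 2 / ((m : ℝ) + 2) ≤ δ / 4 := by
    rw [div_le_iff₀ hδ] at hNδ
    push_cast at hNδ
    rw [div_le_div_iff₀ (by positivity) (by norm_num)]
    linarith
  have hν := nuSet_empProfile_le hα hαβ hβ (chain (m + 2)) (hR _) hFcont hFbd hOM hδ hδ1
    (fun γ hγ => (min_le_left _ _).trans (hdist γ hγ)) hK hm
  have hν0 := (chain (m + 2)).nuSet_nonneg {η | empProfile (m + 2) η ∈ O}
  have hN1 : (1 : ℝ) ≤ (m + 2 : ℕ) := by exact_mod_cast (by omega : 1 ≤ m + 2)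
  set n : ℝ := ((m + 2 : ℕ) : ℝ) with hn
  set E := Real.exp (-(a * n)) with hE
  have hE0 : 0 < E := Real.exp_pos _
  have hE1 : E ≤ 1 := Real.exp_le_one_iff.2 (by nlinarith)
  have hEE : Real.exp (-((δ / 4) ^ 2 / 16 * n)) = E * E := by
    rw [hE, ← Real.exp_add, hadef]; congr 1; ring
  have hpoly : 28 * K * n ^ 2 * E < 1 / 2 := by
    have : 28 * K / a ^ 2 * ((a * n) ^ 2 * E) = 28 * K * n ^ 2 * E := by
      field_simp
    linarith
  rw [hEE] at hν
  have hK0 : (0 : ℝ) ≤ K := Nat.cast_nonneg _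
  have hKE : 0 ≤ K * E := by positivity
  have hn2 : n ≤ n ^ 2 := by nlinarith
  have h4 : 4 * (K * E) ≤ 1 := by nlinarith
  have hνE : (chain (m + 2)).nuSet {η | empProfile (m + 2) η ∈ O} ≤ E / 2 := by
    have : 4 * (K * E) ≤ 1 / 2 := by nlinarith
    nlinarith
  refine ⟨?_, by linarith⟩
  have hrate := (chain (m + 2)).avgRate_le {η | empProfile (m + 2) η ∈ O}
    (Λ := n ^ 2 + 2 * n) (fun η => by
      rw [CTMC.lam, hR]
      exact sum_bdssepR_le hα hα' (hα.trans_le hαβ) hβ η) (by linarith)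
  refine hrate.trans ?_
  calc 2 * (n ^ 2 + 2 * n) * (chain (m + 2)).nuSet {η | empProfile (m + 2) η ∈ O}
      ≤ 2 * (n ^ 2 + 2 * n ^ 2) * (K * (4 * (E * E))) := by gcongr
    _ = (24 * K * n ^ 2 * E) * E := by ring
    _ ≤ 1 * E := by
        refine mul_le_mul_of_nonneg_right ?_ hE0.le
        have : 0 ≤ K * n ^ 2 * E := by positivity
        linarith
    _ = E := one_mul E
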